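/- Let m₀ > 1/2 and assume (1+v²)η(v) ∈ ℋ⁵ on 𝕋 × ℝ. Then there is a constant C such that for n ∈ {±1}, every integer 0 ≤ α ≤ 2, and every real τ: |∂_τ^α K̂(n,τ)| ≤ C / ⟨τ⟩², where K̂(n,τ) = ∫_ℝ e^{−iτt} K(n,t) dt. (The proof uses integration by parts together with the fact that the function t ↦ t η̂₀(t) vanishes at t = 0 and that K(n,·) is continuous but not C¹ at 0.) -/

import Mathlib

open MeasureTheory Real Set

noncomputable section

/-- The measure on `𝕋 × ℝ`, with `𝕋 = ℝ/2πℤ` modeled as `(0, 2π] × ℝ ⊆ ℝ × ℝ`. -/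
def μTR : Measure (ℝ × ℝ) := (volume.restrict (Set.Ioc 0 (2 * π))).prod volume

/-- Partial derivative in the first (space) variable. -/
def pX (f : ℝ → ℝ → ℂ) : ℝ → ℝ → ℂ := fun x v => deriv (fun x' => f x' v) x

/-- Partial derivative in the second (velocity) variable. -/
def pV (f : ℝ → ℝ → ℂ) : ℝ → ℝ → ℂ := fun x v => deriv (fun v' => f x v') v

/-- The weighted integrand `(1+v²)^{m₀} |∂ₓᵖ ∂ᵥ^q f|²`. -/
def wInt (m0 : ℝ) (p q : ℕ) (f : ℝ → ℝ → ℂ) : ℝ × ℝ → ℝ :=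
  fun z => (1 + z.2 ^ 2) ^ m0 * ‖(pX^[p] (pV^[q] f)) z.1 z.2‖ ^ 2

/-- Square of the weighted Sobolev norm: `‖f‖_{ℋⁿ}² = ∑_{p+q ≤ n} ∫ (1+v²)^{m₀}|∂ₓᵖ∂ᵥ^q f|²`. -/
def HnormSq (m0 : ℝ) (n : ℕ) (f : ℝ → ℝ → ℂ) : ℝ :=
  ∑ p ∈ Finset.range (n + 1), ∑ q ∈ Finset.range (n + 1 - p), ∫ z, wInt m0 p q f z ∂μTR

/-- The weighted Sobolev norm `‖f‖_{ℋⁿ}`. -/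
def Hnorm (m0 : ℝ) (n : ℕ) (f : ℝ → ℝ → ℂ) : ℝ := Real.sqrt (HnormSq m0 n f)

/-- Membership in the weighted Sobolev space `ℋⁿ` on `𝕋 × ℝ`. -/
def MemH (m0 : ℝ) (n : ℕ) (f : ℝ → ℝ → ℂ) : Prop :=
  ContDiff ℝ n (Function.uncurry f) ∧
  (∀ v, Function.Periodic (fun x => f x v) (2 * π)) ∧
  ∀ p q : ℕ, p + q ≤ n → Integrable (wInt m0 p q f) μTR

/-- The Fourier coefficient `f̂ₖ(ξ) = (1/2π) ∫_{𝕋×ℝ} f(x,v) e^{-ikx-iξv} dx dv`. -/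
def fHat (f : ℝ → ℝ → ℂ) (k : ℤ) (ξ : ℝ) : ℂ :=
  (1 / (2 * π)) * ∫ z, f z.1 z.2 * Complex.exp (-Complex.I * ((k : ℝ) * z.1 + ξ * z.2)) ∂μTR

/-- The Japanese bracket `⟨t⟩ = (1+t²)^{1/2}`. -/
def jap (t : ℝ) : ℝ := Real.sqrt (1 + t ^ 2)

/-- The Fourier transform `η̂₀(ξ)` of a spatially homogeneous state `η = η(v)`. -/
def etaHat (η : ℝ → ℂ) (ξ : ℝ) : ℂ := fHat (fun _ v => η v) 0 ξ

/-- Fourier coefficients of the HMF kernel `P(x) = cos x`: `p_{±1} = 1/2`, `pₙ = 0` otherwise. -/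
def pcoef (n : ℤ) : ℂ := if n = 1 ∨ n = -1 then 1 / 2 else 0

/-- The kernel `K(n,t) = -n pₙ · nt · η̂₀(nt) 1_{t ≥ 0}`. -/
def Kker (η : ℝ → ℂ) (n : ℤ) (t : ℝ) : ℂ :=
  if 0 ≤ t then -(n : ℂ) * pcoef n * ((n : ℂ) * t) * etaHat η ((n : ℝ) * t) else 0

/-- The Fourier transform `K̂(n,τ) = ∫_ℝ e^{-iτt} K(n,t) dt`, for complex `τ`. -/
def KhatC (η : ℝ → ℂ) (n : ℤ) (τ : ℂ) : ℂ :=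
  ∫ t : ℝ, Complex.exp (-Complex.I * τ * (t : ℂ)) * Kker η n t

/-- The Penrose stability condition (H). -/
def Penrose (m0 : ℝ) (η : ℝ → ℂ) : Prop :=
  MemH m0 5 (fun _ v => (1 + (v : ℂ) ^ 2) * η v) ∧
  ∃ κ > 0, ∀ n : ℤ, n = 1 ∨ n = -1 → ∀ τ : ℂ, τ.im ≤ 0 → κ ≤ ‖1 - KhatC η n τ‖

/-- The Poisson bracket `{f,h} = ∂ₓf ∂ᵥh - ∂ᵥf ∂ₓh`. -/
def pbracket (f h : ℝ → ℝ → ℂ) : ℝ → ℝ → ℂ :=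
  fun x v => pX f x v * pV h x v - pV f x v * pX h x v

/-- The filtered HMF mean-field potential `φ(t,g)(x,v) = ∫ cos(x-y+t(v-u)) g(t,y,u) dy du`. -/
def phiHMF (g : ℝ → ℝ → ℝ → ℂ) (t : ℝ) : ℝ → ℝ → ℂ :=
  fun x v => ∫ z, (Real.cos (x - z.1 + t * (v - z.2)) : ℂ) * g t z.1 z.2 ∂μTR

/-- `g` solves the filtered Vlasov-HMF equation `∂ₜg = {φ(t,g), η} + ε{φ(t,g), g}`. -/
def IsVHMF (ε : ℝ) (η : ℝ → ℂ) (g : ℝ → ℝ → ℝ → ℂ) : Prop :=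
  ∀ t x v, HasDerivAt (fun τ => g τ x v)
    (pbracket (phiHMF g t) (fun _ w => η w) x v + ε * pbracket (phiHMF g t) (g t) x v) t

/-- Global smoothness (in all variables) of `g = g(t,x,v)`. -/
def SmoothG (g : ℝ → ℝ → ℝ → ℂ) : Prop :=
  ∀ n : ℕ, ContDiff ℝ n fun p : ℝ × ℝ × ℝ => g p.1 p.2.1 p.2.2

/-- `ζₖ(t) = ĝₖ(t, kt)`. -/
def zeta (g : ℝ → ℝ → ℝ → ℂ) (k : ℤ) (t : ℝ) : ℂ := fHat (g t) k ((k : ℝ) * t)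

/-- The bound `Q_{T,s}(g) ≤ R`, where
`Q_{T,s}(g) = sup_{[0,T]} ‖g(t)‖_{ℋˢ}/⟨t⟩³ + sup_{[0,T]} max_{k=±1} ⟨t⟩^{s-1}|ζₖ(t)| + sup_{[0,T]} ‖g(t)‖_{ℋ^{s-4}}`. -/
def Qle (m0 : ℝ) (s : ℕ) (g : ℝ → ℝ → ℝ → ℂ) (T R : ℝ) : Prop :=
  ∃ A B C : ℝ, A + B + C ≤ R ∧
    (∀ t ∈ Set.Icc (0 : ℝ) T, Hnorm m0 s (g t) / jap t ^ 3 ≤ A) ∧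
    (∀ t ∈ Set.Icc (0 : ℝ) T, ∀ k : ℤ, k = 1 ∨ k = -1 → jap t ^ (s - 1) * ‖zeta g k t‖ ≤ B) ∧
    (∀ t ∈ Set.Icc (0 : ℝ) T, Hnorm m0 (s - 4) (g t) ≤ C)

/-- A function on the half-line that vanishes at `0` and decays together with two derivatives has
a Fourier–Laplace transform of size `O((1 + τ²)⁻¹)`. -/
theorem exists_norm_integral_Ioi_exp_mul_le {G₀ G₁ G₂ : ℝ → ℂ} {M : ℝ}
    (h₀ : ∀ t, HasDerivAt G₀ (G₁ t) t) (h₁ : ∀ t, HasDerivAt G₁ (G₂ t) t) (h₂ : Continuous G₂)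
    (hzero : G₀ 0 = 0) (b₀ : ∀ t, ‖G₀ t‖ ≤ M * (1 + t ^ 2)⁻¹)
    (b₁ : ∀ t, ‖G₁ t‖ ≤ M * (1 + t ^ 2)⁻¹) (b₂ : ∀ t, ‖G₂ t‖ ≤ M * (1 + t ^ 2)⁻¹) :
    ∃ C : ℝ, ∀ τ : ℝ,
      ‖∫ t in Ioi (0 : ℝ), Complex.exp (-Complex.I * τ * t) * G₀ t‖ ≤ C / (1 + τ ^ 2) := by
  have c₀ : Continuous G₀ := continuous_iff_continuousAt.2 fun t => (h₀ t).continuousAt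
  have c₁ : Continuous G₁ := continuous_iff_continuousAt.2 fun t => (h₁ t).continuousAt
  have hM : Integrable fun t : ℝ => M * (1 + t ^ 2)⁻¹ := integrable_inv_one_add_sq.const_mul M
  have i₀ : Integrable G₀ := hM.mono' c₀.aestronglyMeasurable (.of_forall b₀)
  have i₂ : Integrable G₂ := hM.mono' h₂.aestronglyMeasurable (.of_forall b₂)
  have hlim : Filter.Tendsto (fun t : ℝ => M * (1 + t ^ 2)⁻¹) Filter.atTop (nhds 0) := by
    have : Filter.Tendsto (fun t : ℝ => (1 + t ^ 2)) Filter.atTop Filter.atTop :=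
      Filter.tendsto_atTop_add_const_left _ _ (Filter.tendsto_pow_atTop two_ne_zero)
    simpa using this.inv_tendsto_atTop.const_mul M
  have l₀ : Filter.Tendsto G₀ Filter.atTop (nhds 0) := squeeze_zero_norm b₀ hlim
  have l₁ : Filter.Tendsto G₁ Filter.atTop (nhds 0) := squeeze_zero_norm b₁ hlim
  refine ⟨‖G₁ 0‖ + (∫ t in Ioi (0 : ℝ), ‖G₂ t‖) + ∫ t in Ioi (0 : ℝ), ‖G₀ t‖, fun τ => ?_⟩
  set e : ℝ → ℂ := fun t => Complex.exp (-Complex.I * τ * t) with he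
  have hnorm : ∀ t, ‖e t‖ = 1 := fun t => by
    change ‖Complex.exp (-Complex.I * τ * t)‖ = 1
    rw [show -Complex.I * τ * t = ((-(τ * t) : ℝ) : ℂ) * Complex.I by push_cast; ring,
      Complex.norm_exp_ofReal_mul_I]
  have hec : Continuous e := by fun_prop
  have hed : ∀ t : ℝ, HasDerivAt e (e t * (-Complex.I * τ)) t := fun t => by
    simpa [he] using ((Complex.ofRealCLM.hasDerivAt (x := t)).const_mul (-Complex.I * τ)).cexp
  have ie : ∀ {G : ℝ → ℂ}, Continuous G → Integrable G → Integrable fun t => e t * G t :=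
    fun {G} hc hG => hG.norm.mono' (hec.mul hc).aestronglyMeasurable
      (.of_forall fun t => by simp [hnorm])
  have hbound : ∀ G : ℝ → ℂ,
      ‖∫ t in Ioi (0 : ℝ), e t * G t‖ ≤ ∫ t in Ioi (0 : ℝ), ‖G t‖ := fun G => by
    simpa [hnorm] using norm_integral_le_integral_norm (μ := volume.restrict (Ioi (0 : ℝ)))
      fun t => e t * G t
  have hparts : (∫ t in Ioi (0 : ℝ), (e t * G₂ t + (τ : ℂ) ^ 2 * (e t * G₀ t))) = -G₁ 0 := by
    have := integral_Ioi_of_hasDerivAt_of_tendsto' (a := (0 : ℝ)) (m := (0 : ℂ))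
      (f := fun t => e t * (G₁ t + Complex.I * τ * G₀ t))
      (f' := fun t => e t * G₂ t + (τ : ℂ) ^ 2 * (e t * G₀ t))
      (fun t _ => by
        refine ((hed t).mul ((h₁ t).add ((h₀ t).const_mul (Complex.I * τ)))).congr_deriv ?_
        simp only [Pi.add_apply]
        linear_combination (-(τ : ℂ) ^ 2 * e t * G₀ t) * Complex.I_sq)
      ((ie h₂ i₂).add ((ie c₀ i₀).const_mul _)).integrableOn
      (by
        rw [tendsto_zero_iff_norm_tendsto_zero]
        simpa [hnorm] using (l₁.add (l₀.const_mul (Complex.I * τ))).norm)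
    simpa [hzero, he] using this
  rw [integral_add (ie h₂ i₂).integrableOn ((ie c₀ i₀).const_mul _).integrableOn,
    integral_const_mul] at hparts
  have hτ : τ ^ 2 * ‖∫ t in Ioi (0 : ℝ), e t * G₀ t‖ ≤
      ‖G₁ 0‖ + ∫ t in Ioi (0 : ℝ), ‖G₂ t‖ := by
    have h : (τ : ℂ) ^ 2 * (∫ t in Ioi (0 : ℝ), e t * G₀ t) =
        -G₁ 0 - ∫ t in Ioi (0 : ℝ), e t * G₂ t := by linear_combination hparts
    calc τ ^ 2 * ‖∫ t in Ioi (0 : ℝ), e t * G₀ t‖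
        = ‖(τ : ℂ) ^ 2 * (∫ t in Ioi (0 : ℝ), e t * G₀ t)‖ := by simp
      _ ≤ ‖-G₁ 0‖ + ‖∫ t in Ioi (0 : ℝ), e t * G₂ t‖ := by rw [h]; exact norm_sub_le _ _
      _ ≤ _ := by rw [norm_neg]; gcongr; exact hbound G₂
  rw [le_div_iff₀ (by positivity)]
  linarith [hbound G₀]

/-- The half-line bound for `t ↦ t ^ β ψ(t)`, where `ψ` and two derivatives decay like `|t|⁻⁵`. -/
theorem exists_norm_integral_Ioi_exp_mul_pow_le {ψ : ℕ → ℝ → ℂ} {M : ℝ}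
    (hψ : ∀ i < 2, ∀ t, HasDerivAt (ψ i) (ψ (i + 1) t) t) (hψc : Continuous (ψ 2))
    (hM : ∀ i ≤ 2, ∀ m ≤ 5, ∀ t : ℝ, |t| ^ m * ‖ψ i t‖ ≤ M) {α : ℕ} (hα : α ≤ 2) :
    ∃ C : ℝ, ∀ τ : ℝ,
      ‖∫ t in Ioi (0 : ℝ), Complex.exp (-Complex.I * τ * t) * ((t : ℂ) ^ (α + 1) * ψ 0 t)‖ ≤
        C / (1 + τ ^ 2) := by
  have hpow : ∀ (β : ℕ) (t : ℝ), HasDerivAt (fun t : ℝ => (t : ℂ) ^ β) (β * (t : ℂ) ^ (β - 1)) t :=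
    fun β t => by simpa using (Complex.ofRealCLM.hasDerivAt (x := t)).fun_pow β
  have hterm : ∀ i ≤ 2, ∀ m ≤ 3, ∀ t : ℝ,
      ‖(t : ℂ) ^ m * ψ i t‖ ≤ 2 * M * (1 + t ^ 2)⁻¹ := fun i hi m hm t => by
    rw [← div_eq_mul_inv, le_div_iff₀ (by positivity), norm_mul, norm_pow, Complex.norm_real,
      Real.norm_eq_abs]
    have h1 := hM i hi m (by omega) t
    have h2 := hM i hi (m + 2) (by omega) t
    rw [pow_add, sq_abs] at h2
    linarith
  have hpos : ∀ t : ℝ, 0 ≤ 2 * M * (1 + t ^ 2)⁻¹ := fun t =>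
    (norm_nonneg _).trans (hterm 0 (by omega) 0 (by omega) t)
  have hαr : (α : ℝ) ≤ 2 := by exact_mod_cast hα
  refine exists_norm_integral_Ioi_exp_mul_le (M := 13 * (2 * M))
    (G₁ := fun t => (α + 1 : ℕ) * ((t : ℂ) ^ α * ψ 0 t) + (t : ℂ) ^ (α + 1) * ψ 1 t)
    (G₂ := fun t => (α + 1 : ℕ) * α * ((t : ℂ) ^ (α - 1) * ψ 0 t) +
      2 * (α + 1 : ℕ) * ((t : ℂ) ^ α * ψ 1 t) + (t : ℂ) ^ (α + 1) * ψ 2 t)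
    (fun t => ?_) (fun t => ?_) ?_ (by simp) (fun t => ?_) (fun t => ?_) (fun t => ?_)
  · refine ((hpow (α + 1) t).mul (hψ 0 (by omega) t)).congr_deriv ?_
    simp only [Nat.add_sub_cancel]; ring
  · refine ((((hpow α t).mul (hψ 0 (by omega) t)).const_mul ((α + 1 : ℕ) : ℂ)).add
      ((hpow (α + 1) t).mul (hψ 1 (by omega) t))).congr_deriv ?_
    simp only [Nat.add_sub_cancel]; ring
  · have c₀ : Continuous (ψ 0) :=
      continuous_iff_continuousAt.2 fun t => (hψ 0 (by omega) t).continuousAt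
    have c₁ : Continuous (ψ 1) :=
      continuous_iff_continuousAt.2 fun t => (hψ 1 (by omega) t).continuousAt
    fun_prop
  · nlinarith [hterm 0 (by omega) (α + 1) (by omega) t, hpos t]
  · refine (norm_add_le _ _).trans ?_
    have h1 := hterm 0 (by omega) α (by omega) t
    have h2 := hterm 1 (by omega) (α + 1) (by omega) t
    rw [norm_mul, Complex.norm_natCast]
    have h3 : ((α + 1 : ℕ) : ℝ) * ‖(t : ℂ) ^ α * ψ 0 t‖ ≤ 3 * (2 * M * (1 + t ^ 2)⁻¹) := by
      gcongr
      push_cast; linarith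
    nlinarith [hpos t]
  · refine norm_add₃_le.trans ?_
    have h1 := hterm 0 (by omega) (α - 1) (by omega) t
    have h2 := hterm 1 (by omega) α (by omega) t
    have h3 := hterm 2 (by omega) (α + 1) (by omega) t
    rw [norm_mul _ ((t : ℂ) ^ (α - 1) * ψ 0 t), norm_mul _ ((t : ℂ) ^ α * ψ 1 t),
      norm_mul _ (α : ℂ), norm_mul 2 _, Complex.norm_natCast, Complex.norm_natCast,
      Complex.norm_two]
    have h4 : ((α + 1 : ℕ) : ℝ) * α * ‖(t : ℂ) ^ (α - 1) * ψ 0 t‖ ≤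
        3 * 2 * (2 * M * (1 + t ^ 2)⁻¹) := by
      gcongr
      push_cast; linarith
    have h5 : 2 * ((α + 1 : ℕ) : ℝ) * ‖(t : ℂ) ^ α * ψ 1 t‖ ≤
        2 * 3 * (2 * M * (1 + t ^ 2)⁻¹) := by
      gcongr
      push_cast; linarith
    linarith

theorem iterate_pV_const (F : ℝ → ℂ) (q : ℕ) :
    pV^[q] (fun _ v => F v) = fun _ v => iteratedDeriv q F v := by
  induction q with
  | zero => simp
  | succ q ih => rw [Function.iterate_succ_apply', ih, iteratedDeriv_succ]; rfl

theorem MemH.contDiff_profile {m0 : ℝ} {N : ℕ} {F : ℝ → ℂ} (h : MemH m0 N fun _ v => F v) :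
    ContDiff ℝ N F :=
  ContDiff.comp (g := Function.uncurry fun _ v : ℝ => F v) (f := fun v : ℝ => ((0 : ℝ), v)) h.1
    (contDiff_const.prodMk contDiff_id)

/-- Derivatives of a spatially homogeneous element of a weighted Sobolev space are integrable. -/
theorem MemH.integrable_iteratedDeriv {m0 : ℝ} (hm0 : 1 / 2 < m0) {N : ℕ} {F : ℝ → ℂ}
    (h : MemH m0 N fun _ v => F v) {q : ℕ} (hq : q ≤ N) :
    Integrable (iteratedDeriv q F) := by
  have hw : ∀ z : ℝ × ℝ, wInt m0 0 q (fun _ v => F v) z =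
      (1 + z.2 ^ 2) ^ m0 * ‖iteratedDeriv q F z.2‖ ^ 2 := fun z => by
    simp [wInt, iterate_pV_const]
  have h1 := (h.2.2 0 q (by omega)).prod_right_ae
  have : (volume.restrict (Set.Ioc 0 (2 * π))) ≠ 0 := by
    rw [Ne, Measure.restrict_eq_zero]
    simp [Real.pi_pos]
  have : Filter.NeBot (ae (volume.restrict (Set.Ioc 0 (2 * π)))) := ae_neBot.2 this
  obtain ⟨x, hx⟩ := h1.exists
  simp only [hw] at hx
  have h2 : Integrable fun v : ℝ => (1 + v ^ 2) ^ (-m0) := by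
    have := integrable_rpow_neg_one_add_norm_sq (E := ℝ) (μ := volume) (r := 2 * m0)
      (by simp; linarith)
    simpa [neg_div] using this
  refine (hx.add h2).mono'
    (h.contDiff_profile.continuous_iteratedDeriv q (by exact_mod_cast hq)).aestronglyMeasurable
    (.of_forall fun v => ?_)
  have hp : (0 : ℝ) < 1 + v ^ 2 := by positivity
  have ha := Real.rpow_pos_of_pos hp m0
  set a := (1 + v ^ 2 : ℝ) ^ m0
  set y := ‖iteratedDeriv q F v‖
  simp only [Pi.add_apply, Real.rpow_neg hp.le]
  change y ≤ a * y ^ 2 + a⁻¹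
  have : a * y ^ 2 + a⁻¹ - y = a⁻¹ * ((a * y - 1 / 2) ^ 2 + 3 / 4) := by
    field_simp; ring
  have : 0 ≤ a⁻¹ * ((a * y - 1 / 2) ^ 2 + 3 / 4) := by positivity
  linarith

theorem iteratedDeriv_one_add_sq_bound (j : ℕ) (v : ℝ) :
    ‖iteratedDeriv j (fun v : ℝ => 1 + (v : ℂ) ^ 2) v‖ ≤ 2 * (1 + v ^ 2) := by
  have h1 : deriv (fun v : ℝ => 1 + (v : ℂ) ^ 2) = fun v : ℝ => 2 * (v : ℂ) := by
    ext v
    have := ((Complex.ofRealCLM.hasDerivAt (x := v)).fun_pow 2).const_add (1 : ℂ)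
    simpa using this.deriv
  have h2 : deriv (fun v : ℝ => 2 * (v : ℂ)) = fun _ => 2 := by
    ext v
    have := (Complex.ofRealCLM.hasDerivAt (x := v)).const_mul (2 : ℂ)
    simpa using this.deriv
  rcases j with _ | _ | _ | j
  · have : ‖(1 + (v : ℂ) ^ 2)‖ = 1 + v ^ 2 := by
      rw [show (1 + (v : ℂ) ^ 2) = ((1 + v ^ 2 : ℝ) : ℂ) by push_cast; ring, Complex.norm_real,
        Real.norm_of_nonneg (by positivity)]
    rw [iteratedDeriv_zero, this]
    nlinarith [sq_nonneg v]
  · rw [zero_add, iteratedDeriv_one, h1]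
    simp only [norm_mul, Complex.norm_two, Complex.norm_real, Real.norm_eq_abs]
    nlinarith [sq_nonneg (|v| - 1), sq_abs v]
  · rw [iteratedDeriv_succ', iteratedDeriv_succ', iteratedDeriv_zero, h1, h2]
    simp only [Complex.norm_two]
    nlinarith [sq_nonneg v]
  · rw [iteratedDeriv_succ', iteratedDeriv_succ', iteratedDeriv_succ', h1, h2]
    simp only [deriv_const']
    simp
    positivity

/-- Integrability of the derivatives of `(1 + v²) η` passes to the weighted derivatives of `η`. -/
theorem integrable_one_add_sq_mul_iteratedDeriv {N : ℕ} {η : ℝ → ℂ} (hη : ContDiff ℝ N η)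
    (hF : ∀ q ≤ N, Integrable (iteratedDeriv q fun v : ℝ => (1 + (v : ℂ) ^ 2) * η v))
    (q : ℕ) (hq : q ≤ N) : Integrable fun v : ℝ => (1 + v ^ 2) * ‖iteratedDeriv q η v‖ := by
  induction q using Nat.strong_induction_on with
  | _ q ih =>
  set p : ℝ → ℂ := fun v => 1 + (v : ℂ) ^ 2 with hp
  have hps : ∀ k : ℕ, ContDiff ℝ k p := fun k =>
    contDiff_const.add (Complex.ofRealCLM.contDiff.pow 2)
  have hηc : ∀ i ≤ N, Continuous (iteratedDeriv i η) := fun i hi =>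
    hη.continuous_iteratedDeriv i (by exact_mod_cast hi)
  have hsum : ∀ v, p v * iteratedDeriv q η v = iteratedDeriv q (fun v => p v * η v) v -
      ∑ i ∈ Finset.range q, q.choose i * iteratedDeriv i η v * iteratedDeriv (q - i) p v := by
    intro v
    have h := iteratedDeriv_mul (x := v) (n := q) (f := η) (g := p)
      (hη.contDiffAt.of_le (by exact_mod_cast hq)) (hps q).contDiffAt
    rw [Finset.sum_range_succ] at h
    rw [show (fun v => p v * η v) = η * p by ext; simp [mul_comm], h]
    simp [mul_comm]
  have hint : Integrable fun v => p v * iteratedDeriv q η v := by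
    simp_rw [hsum]
    refine (hF q hq).sub (integrable_finsetSum _ fun i hi => ?_)
    have hi := Finset.mem_range.1 hi
    refine ((ih i hi (by omega)).const_mul (q.choose i * 2)).mono' ?_ (.of_forall fun v => ?_)
    · have := hηc i (by omega)
      have := (hps q).continuous_iteratedDeriv (q - i) (by exact_mod_cast Nat.sub_le q i)
      exact Continuous.aestronglyMeasurable (by fun_prop)
    · rw [norm_mul, norm_mul, Complex.norm_natCast]
      calc _ ≤ (q.choose i : ℝ) * ‖iteratedDeriv i η v‖ * (2 * (1 + v ^ 2)) := by
            gcongr; exact iteratedDeriv_one_add_sq_bound _ _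
        _ = _ := by ring
  refine hint.norm.congr (.of_forall fun v => ?_)
  have : ‖p v‖ = 1 + v ^ 2 := by
    rw [show p v = ((1 + v ^ 2 : ℝ) : ℂ) by simp [hp], Complex.norm_real,
      Real.norm_of_nonneg (by positivity)]
  simp [this]

open scoped FourierTransform in
theorem etaHat_eq_fourier (η : ℝ → ℂ) (ξ : ℝ) : etaHat η ξ = 𝓕 η (ξ / (2 * π)) := by
  have hπ : (π : ℂ) ≠ 0 := by exact_mod_cast Real.pi_ne_zero
  rw [etaHat, fHat, μTR, Real.fourier_real_eq_integral_exp_smul]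
  have := integral_fun_snd (μ := volume.restrict (Set.Ioc 0 (2 * π))) (ν := volume)
    (fun v : ℝ => η v * Complex.exp (-Complex.I * (ξ * v)))
  simp only [Int.cast_zero, Complex.ofReal_zero, zero_mul, zero_add]
  rw [this]
  simp only [MeasurableSet.univ, measureReal_restrict_apply, univ_inter, Real.volume_real_Ioc,
    sub_zero, max_eq_left Real.two_pi_pos.le, Complex.real_smul]
  push_cast
  rw [← mul_assoc, one_div_mul_cancel (by simp), one_mul]
  refine integral_congr_ae (.of_forall fun v => ?_)
  simp only [smul_eq_mul]
  rw [mul_comm]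
  congr 2
  field_simp

open scoped FourierTransform in
theorem KhatC_eq_fourier (η : ℝ → ℂ) (n : ℤ) (τ : ℝ) :
    KhatC η n τ = 𝓕 (Kker η n) ((2 * π)⁻¹ * τ) := by
  have hπ : (π : ℂ) ≠ 0 := by exact_mod_cast Real.pi_ne_zero
  rw [KhatC, Real.fourier_real_eq_integral_exp_smul]
  refine integral_congr_ae (.of_forall fun t => ?_)
  simp only [smul_eq_mul]
  congr 2
  push_cast
  field_simp

open scoped FourierTransform in
/-- The Fourier transform of `η`, and its first two derivatives, decay like `|w|⁻⁵`. -/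
theorem exists_pow_mul_norm_iteratedDeriv_fourier_le {N : ℕ} {η : ℝ → ℂ} (hη : ContDiff ℝ N η)
    (hint : ∀ q ≤ N, Integrable fun v : ℝ => (1 + v ^ 2) * ‖iteratedDeriv q η v‖) :
    ContDiff ℝ 2 (𝓕 η) ∧
      ∃ M : ℝ, ∀ i ≤ 2, ∀ m ≤ N, ∀ w : ℝ, |w| ^ m * ‖iteratedDeriv i (𝓕 η) w‖ ≤ M := by
  have hw : ∀ k n : ℕ, (k : ℕ∞) ≤ (2 : ℕ) → (n : ℕ∞) ≤ N →
      Integrable fun v : ℝ => ‖v‖ ^ k * ‖iteratedFDeriv ℝ n η v‖ := by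
    intro k n hk hn
    have hk : k ≤ 2 := by exact_mod_cast hk
    have hn : n ≤ N := by exact_mod_cast hn
    have hc := hη.continuous_iteratedDeriv n (by exact_mod_cast hn)
    refine (hint n hn).mono' ?_ (.of_forall fun v => ?_)
    · simp_rw [norm_iteratedFDeriv_eq_norm_iteratedDeriv]
      exact Continuous.aestronglyMeasurable (by fun_prop)
    · rw [norm_iteratedFDeriv_eq_norm_iteratedDeriv, Real.norm_of_nonneg (by positivity)]
      gcongr
      rw [Real.norm_eq_abs]
      interval_cases k
      · nlinarith [sq_nonneg v]
      · nlinarith [sq_nonneg (|v| - 1), sq_abs v]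
      · rw [sq_abs]; linarith
  refine ⟨?_, ?_⟩
  · exact Real.contDiff_fourier (N := (2 : ℕ)) fun k hk => by simpa using hw k 0 hk (by simp)
  · have key : ∀ i m : ℕ, ∃ M : ℝ, i ≤ 2 → m ≤ N →
        ∀ w : ℝ, |w| ^ m * ‖iteratedDeriv i (𝓕 η) w‖ ≤ M := by
      intro i m
      by_cases h : i ≤ 2 ∧ m ≤ N
      · have hb := Real.pow_mul_norm_iteratedFDeriv_fourier_le (K := (2 : ℕ)) (N := (N : ℕ∞))
          hη hw (k := i) (n := m) (by exact_mod_cast h.1) (by exact_mod_cast h.2)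
        simp only [norm_iteratedFDeriv_eq_norm_iteratedDeriv (f := 𝓕 η), Real.norm_eq_abs] at hb
        exact ⟨_, fun _ _ => hb⟩
      · exact ⟨0, fun h1 h2 => absurd ⟨h1, h2⟩ h⟩
    choose M hM using key
    refine ⟨∑ i ∈ Finset.range 3, ∑ m ∈ Finset.range (N + 1), |M i m|, fun i hi m hm w => ?_⟩
    calc _ ≤ |M i m| := (hM i m hi hm w).trans (le_abs_self _)
      _ ≤ ∑ m ∈ Finset.range (N + 1), |M i m| := Finset.single_le_sum (f := fun m => |M i m|)
          (fun _ _ => abs_nonneg _) (Finset.mem_range.2 (by omega))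
      _ ≤ _ := Finset.single_le_sum (f := fun i => ∑ m ∈ Finset.range (N + 1), |M i m|)
          (fun _ _ => Finset.sum_nonneg fun _ _ => abs_nonneg _) (Finset.mem_range.2 (by omega))

open scoped FourierTransform in
/-- Decay of a single `τ`-derivative of the transformed kernel. -/
theorem exists_norm_iteratedDeriv_KhatC_le {η : ℝ → ℂ} (hφ : ContDiff ℝ 2 (𝓕 η)) {M : ℝ}
    (hM : ∀ i ≤ 2, ∀ m ≤ 5, ∀ w : ℝ, |w| ^ m * ‖iteratedDeriv i (𝓕 η) w‖ ≤ M)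
    {n : ℤ} (hn : n ≠ 0) {α : ℕ} (hα : α ≤ 2) :
    ∃ C : ℝ, ∀ τ : ℝ,
      ‖iteratedDeriv α (fun τ' : ℝ => KhatC η n (τ' : ℂ)) τ‖ ≤ C / (1 + τ ^ 2) := by
  set b : ℝ := n / (2 * π) with hb
  have hb0 : b ≠ 0 := by positivity
  set c : ℂ := -(n : ℂ) * pcoef n * n
  set ψ : ℕ → ℝ → ℂ := fun i t => c * (b : ℂ) ^ i * iteratedDeriv i (𝓕 η) (b * t) with hψ
  have hK : ∀ t, Kker η n t = (Ici (0 : ℝ)).indicator (fun t => (t : ℂ) * ψ 0 t) t := fun t => by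
    simp only [Kker, Set.indicator_apply, mem_Ici, etaHat_eq_fourier]
    congr 1
    rw [hψ]
    simp only [pow_zero, iteratedDeriv_zero]
    rw [show (n : ℝ) * t / (2 * π) = b * t by rw [hb]; ring]
    ring
  have hcont : ∀ i ≤ 2, Continuous (ψ i) := fun i hi => by
    have := hφ.continuous_iteratedDeriv i (by exact_mod_cast hi)
    fun_prop
  have hderiv : ∀ i < 2, ∀ t, HasDerivAt (ψ i) (ψ (i + 1) t) t := fun i hi t => by
    have h1 := (hφ.differentiable_iteratedDeriv i (by exact_mod_cast hi) (b * t)).hasDerivAt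
    rw [← iteratedDeriv_succ] at h1
    have h2 := (h1.scomp t ((hasDerivAt_id t).const_mul b)).const_mul (c * (b : ℂ) ^ i)
    refine h2.congr_deriv ?_
    simp only [hψ, mul_one, Complex.real_smul]
    ring
  set M' : ℝ := ∑ i ∈ Finset.range 3, ∑ m ∈ Finset.range 6, ‖c‖ * |b| ^ i * (|b| ^ m)⁻¹ * M
  have hM0 : 0 ≤ M := (by positivity : (0 : ℝ) ≤ _).trans (hM 0 (by omega) 0 (by omega) 0)
  have hbound : ∀ i ≤ 2, ∀ m ≤ 5, ∀ t : ℝ, |t| ^ m * ‖ψ i t‖ ≤ M' := fun i hi m hm t => by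
    have h1 := hM i hi m hm (b * t)
    have hbp : 0 < |b| := abs_pos.2 hb0
    calc |t| ^ m * ‖ψ i t‖
        = ‖c‖ * |b| ^ i * (|b| ^ m)⁻¹ * (|b * t| ^ m * ‖iteratedDeriv i (𝓕 η) (b * t)‖) := by
          simp only [hψ, norm_mul, norm_pow, Complex.norm_real, Real.norm_eq_abs, abs_mul, mul_pow]
          field_simp
      _ ≤ ‖c‖ * |b| ^ i * (|b| ^ m)⁻¹ * M := by gcongr
      _ ≤ ∑ m ∈ Finset.range 6, ‖c‖ * |b| ^ i * (|b| ^ m)⁻¹ * M :=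
          Finset.single_le_sum (f := fun m => ‖c‖ * |b| ^ i * (|b| ^ m)⁻¹ * M)
            (fun _ _ => by positivity) (Finset.mem_range.2 (by omega))
      _ ≤ M' := Finset.single_le_sum
            (f := fun i => ∑ m ∈ Finset.range 6, ‖c‖ * |b| ^ i * (|b| ^ m)⁻¹ * M)
            (fun _ _ => by positivity) (Finset.mem_range.2 (by omega))
  have hint : ∀ k : ℕ, k ≤ 2 → Integrable fun t : ℝ => t ^ k • Kker η n t := fun k hk => by
    have hi : Integrable fun t : ℝ => (t : ℂ) ^ (k + 1) * ψ 0 t := by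
      refine (integrable_inv_one_add_sq.const_mul (2 * M')).mono' ?_ (.of_forall fun t => ?_)
      · have := hcont 0 (by omega)
        exact Continuous.aestronglyMeasurable (by fun_prop)
      · rw [← div_eq_mul_inv, le_div_iff₀ (by positivity), norm_mul, norm_pow, Complex.norm_real,
          Real.norm_eq_abs]
        have h1 := hbound 0 (by omega) (k + 1) (by omega) t
        have h2 := hbound 0 (by omega) (k + 1 + 2) (by omega) t
        rw [pow_add _ (k + 1), sq_abs] at h2
        linarith
    refine (hi.indicator measurableSet_Ici (s := Ici (0 : ℝ))).congr (.of_forall fun t => ?_)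
    simp only [hK, Set.indicator_apply, Complex.real_smul]
    split_ifs
    · push_cast; ring
    · simp
  obtain ⟨C, hC⟩ := exists_norm_integral_Ioi_exp_mul_pow_le hderiv (hcont 2 le_rfl) hbound hα
  have hsmooth : ContDiff ℝ α (𝓕 (Kker η n)) :=
    Real.contDiff_fourier (N := (α : ℕ∞)) fun k hk => by
      have hk : k ≤ α := by exact_mod_cast hk
      simpa [norm_smul] using (hint k (by omega)).norm
  refine ⟨C, fun τ => ?_⟩
  simp_rw [KhatC_eq_fourier]
  have hcomp := congrFun (iteratedDeriv_comp_const_smul hsmooth (2 * π)⁻¹) τ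
  rw [hcomp, Real.iteratedDeriv_fourier (N := (2 : ℕ)) (fun k hk => hint k (by exact_mod_cast hk))
    (by exact_mod_cast hα)]
  refine le_trans (le_of_eq ?_) (hC τ)
  have hπ : (π : ℂ) ≠ 0 := by exact_mod_cast Real.pi_ne_zero
  have hI : 𝓕 (fun t : ℝ => (-2 * π * Complex.I * t) ^ α • Kker η n t) ((2 * π)⁻¹ * τ) =
      (-2 * π * Complex.I) ^ α *
        ∫ t in Ioi (0 : ℝ), Complex.exp (-Complex.I * τ * t) * ((t : ℂ) ^ (α + 1) * ψ 0 t) := by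
    rw [Real.fourier_real_eq_integral_exp_smul, ← integral_const_mul, ← integral_Ici_eq_integral_Ioi,
      ← integral_indicator measurableSet_Ici]
    refine integral_congr_ae (.of_forall fun t => ?_)
    simp only [hK, Set.indicator_apply, smul_eq_mul]
    split_ifs
    · rw [show ((-2 * π * t * ((2 * π)⁻¹ * τ) : ℝ) : ℂ) * Complex.I = -Complex.I * τ * t by
        push_cast; field_simp]
      ring
    · simp
  rw [hI, norm_smul, norm_mul, ← mul_assoc]
  have : ‖(2 * π : ℝ)⁻¹ ^ α‖ * ‖(-2 * π * Complex.I : ℂ) ^ α‖ = 1 := by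
    simp only [norm_pow, norm_mul, norm_inv, norm_neg, Complex.norm_two, Complex.norm_real,
      Complex.norm_I, Real.norm_two, mul_one, ← mul_pow]
    rw [inv_mul_cancel₀ (by simp), one_pow]
  rw [this, one_mul]

/-- **Decay of the Fourier transform of the kernel.** Let `m₀ > 1/2` and assume
`(1+v²)η(v) ∈ ℋ⁵`. Then there is a constant `C` such that for `n = ±1`, every integer
`0 ≤ α ≤ 2` and every real `τ`: `|∂_τ^α K̂(n,τ)| ≤ C/⟨τ⟩²`. -/
theorem kernel_fourier_decay (m0 : ℝ) (hm0 : 1 / 2 < m0) (η : ℝ → ℂ)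
    (hη : MemH m0 5 fun _ v => (1 + (v : ℂ) ^ 2) * η v) :
    ∃ C : ℝ, ∀ n : ℤ, n = 1 ∨ n = -1 → ∀ α : ℕ, α ≤ 2 → ∀ τ : ℝ,
      ‖iteratedDeriv α (fun τ' : ℝ => KhatC η n (τ' : ℂ)) τ‖ ≤ C / jap τ ^ 2 := by
  have hF : ContDiff ℝ (5 : ℕ) fun v : ℝ => (1 + (v : ℂ) ^ 2) * η v := hη.contDiff_profile
  have hne : ∀ v : ℝ, 1 + (v : ℂ) ^ 2 ≠ 0 := fun v => by
    exact_mod_cast (by positivity : (0 : ℝ) < 1 + v ^ 2).ne'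
  have hηs : ContDiff ℝ (5 : ℕ) η := by
    have hp : ContDiff ℝ (5 : ℕ) fun v : ℝ => 1 + (v : ℂ) ^ 2 :=
      contDiff_const.add (Complex.ofRealCLM.contDiff.pow 2)
    have h : η = fun v : ℝ => (1 + (v : ℂ) ^ 2)⁻¹ * ((1 + (v : ℂ) ^ 2) * η v) :=
      funext fun v => (inv_mul_cancel_left₀ (hne v) (η v)).symm
    rw [h]
    exact (hp.inv hne).mul hF
  obtain ⟨hφ, M, hM⟩ := exists_pow_mul_norm_iteratedDeriv_fourier_le hηs
    (integrable_one_add_sq_mul_iteratedDeriv hηs fun q hq =>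
      MemH.integrable_iteratedDeriv hm0 hη hq)
  have key : ∀ (n : ℤ) (α : ℕ), ∃ C : ℝ, n ≠ 0 → α ≤ 2 → ∀ τ : ℝ,
      ‖iteratedDeriv α (fun τ' : ℝ => KhatC η n (τ' : ℂ)) τ‖ ≤ C / (1 + τ ^ 2) := fun n α => by
    by_cases h : n ≠ 0 ∧ α ≤ 2
    · obtain ⟨C, hC⟩ := exists_norm_iteratedDeriv_KhatC_le hφ hM h.1 h.2
      exact ⟨C, fun _ _ => hC⟩
    · exact ⟨0, fun h1 h2 => absurd ⟨h1, h2⟩ h⟩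
  choose C hC using key
  refine ⟨∑ n ∈ ({1, -1} : Finset ℤ), ∑ α ∈ Finset.range 3, |C n α|, fun n hn α hα τ => ?_⟩
  have hn0 : n ≠ 0 := by omega
  rw [jap, Real.sq_sqrt (by positivity)]
  refine (hC n α hn0 hα τ).trans ?_
  gcongr
  calc C n α ≤ |C n α| := le_abs_self _
    _ ≤ ∑ α ∈ Finset.range 3, |C n α| := Finset.single_le_sum (f := fun α => |C n α|)
        (fun _ _ => abs_nonneg _) (Finset.mem_range.2 (by omega))
    _ ≤ _ := Finset.single_le_sum (f := fun n => ∑ α ∈ Finset.range 3, |C n α|)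
        (fun _ _ => Finset.sum_nonneg fun _ _ => abs_nonneg _) (by simpa using hn)
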